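/- arXiv:2511.06142 — 4 statements merged into one kernel-verified Lean document; each statement's English description precedes it below -/
import Mathlib

section
/- Self-normalized martingale tail (Lemma 2): Let D be a positive integer, λ > 0, μ ≥ ε > 0, and δ ∈ (0,1). Let (F_t)_{t≥0} be a filtration, let η_t be conditionally 1-sub-Gaussian given F_{t-1}, and let A_t ∈ ℝ^D and w_t ∈ [ε, μ] be F_{t-1}-measurable. Define Y_t = Σ_{s=1}^t w_s A_s η_s and V_t = λI + Σ_{s=1}^t w_s A_s A_sᵀ. Then with probability at least 1 − δ, simultaneously for all t ≤ T: Y_tᵀ V_t^{-1} Y_t ≤ 2μ · ln( det(V_t)^{1/2} / ( det(λI)^{1/2} · δ ) ). -/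
open MeasureTheory Matrix Finset

/-- The integral of an exponential of a quadratic with negative leading coefficient. -/
lemma lintegral_exp_neg_mul_sq_add_mul {b : ℝ} (hb : 0 < b) (c : ℝ) :
    ∫⁻ x : ℝ, ENNReal.ofReal (Real.exp (-b * x ^ 2 + c * x)) =
      ENNReal.ofReal (Real.sqrt (Real.pi / b) * Real.exp (c ^ 2 / (4 * b))) := by
  have hint : Integrable fun x : ℝ => Real.exp (-b * (x - c / (2 * b)) ^ 2) :=
    (integrable_exp_neg_mul_sq hb).comp_sub_right (c / (2 * b))
  have heq : ∀ x : ℝ, Real.exp (-b * x ^ 2 + c * x) =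
      Real.exp (-b * (x - c / (2 * b)) ^ 2) * Real.exp (c ^ 2 / (4 * b)) := fun x => by
    rw [← Real.exp_add]
    congr 1
    field_simp
    ring
  simp_rw [heq]
  rw [← ofReal_integral_eq_lintegral_ofReal (hint.mul_const _)
    (Filter.Eventually.of_forall fun x => by positivity), integral_mul_const,
    integral_sub_right_eq_self (fun x : ℝ => Real.exp (-b * x ^ 2)), integral_gaussian]

/-- A sub-Gaussian measure on the line is dominated by the standard Gaussian measure on
exponentials of quadratics. -/
lemma lintegral_exp_quadratic_le_of_subgaussian (κ : Measure ℝ) [SFinite κ]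
    (hκ : ∀ u : ℝ, ∫⁻ y, ENNReal.ofReal (Real.exp (u * y)) ∂κ ≤
      ENNReal.ofReal (Real.exp (u ^ 2 / 2)))
    (a : ℝ) {b : ℝ} (hb0 : 0 ≤ b) (hb : b < 1 / 2) :
    ∫⁻ y, ENNReal.ofReal (Real.exp (a * y + b * y ^ 2)) ∂κ ≤
      ENNReal.ofReal (Real.exp (a ^ 2 / (2 * (1 - 2 * b))) / Real.sqrt (1 - 2 * b)) := by
  rcases hb0.eq_or_lt with rfl | hb0
  · simpa using hκ a
  have hβ : 0 < 1 / (4 * b) := by positivity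
  have h1 : 0 < 1 - 2 * b := by linarith
  have hγ : 0 < (1 - 2 * b) / (4 * b) := by positivity
  set S := Real.sqrt (Real.pi / (1 / (4 * b))) with hS
  have hSpos : 0 < S := Real.sqrt_pos.2 (by positivity)
  have hmix : ∀ y : ℝ, ENNReal.ofReal (Real.exp (a * y + b * y ^ 2)) =
      ENNReal.ofReal S⁻¹ * ∫⁻ g : ℝ,
        ENNReal.ofReal (Real.exp (-(1 / (4 * b)) * g ^ 2)) *
          ENNReal.ofReal (Real.exp ((a + g) * y)) := fun y => by
    have : ∀ g : ℝ, ENNReal.ofReal (Real.exp (-(1 / (4 * b)) * g ^ 2)) *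
          ENNReal.ofReal (Real.exp ((a + g) * y)) = ENNReal.ofReal (Real.exp (a * y)) *
            ENNReal.ofReal (Real.exp (-(1 / (4 * b)) * g ^ 2 + y * g)) := fun g => by
      rw [← ENNReal.ofReal_mul (by positivity), ← ENNReal.ofReal_mul (by positivity),
        ← Real.exp_add, ← Real.exp_add]
      ring_nf
    simp_rw [this]
    rw [lintegral_const_mul _ (by fun_prop), lintegral_exp_neg_mul_sq_add_mul hβ, ← hS,
      ← ENNReal.ofReal_mul (by positivity), ← ENNReal.ofReal_mul (by positivity)]
    congr 1
    rw [Real.exp_add]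
    field_simp
  calc ∫⁻ y, ENNReal.ofReal (Real.exp (a * y + b * y ^ 2)) ∂κ
      = ENNReal.ofReal S⁻¹ * ∫⁻ g : ℝ, ∫⁻ y,
        ENNReal.ofReal (Real.exp (-(1 / (4 * b)) * g ^ 2)) *
          ENNReal.ofReal (Real.exp ((a + g) * y)) ∂κ := by
        simp_rw [hmix]
        rw [lintegral_const_mul _ (by fun_prop), lintegral_lintegral_swap (by fun_prop)]
    _ ≤ ENNReal.ofReal S⁻¹ * ∫⁻ g : ℝ, ENNReal.ofReal (Real.exp (a ^ 2 / 2)) *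
        ENNReal.ofReal (Real.exp (-((1 - 2 * b) / (4 * b)) * g ^ 2 + a * g)) := by
        gcongr with g
        rw [lintegral_const_mul _ (by fun_prop)]
        refine (mul_le_mul_right (hκ (a + g)) _).trans_eq ?_
        rw [← ENNReal.ofReal_mul (by positivity), ← ENNReal.ofReal_mul (by positivity),
          ← Real.exp_add, ← Real.exp_add]
        congr 2
        field_simp
        ring
    _ = _ := by
        rw [lintegral_const_mul _ (by fun_prop), lintegral_exp_neg_mul_sq_add_mul hγ,
          ← ENNReal.ofReal_mul (by positivity), ← ENNReal.ofReal_mul (by positivity)]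
        have h2 : Real.sqrt (Real.pi / ((1 - 2 * b) / (4 * b))) =
            S / Real.sqrt (1 - 2 * b) := by
          rw [hS, ← Real.sqrt_div (by positivity)]
          congr 1
          field_simp
        have h3 : a ^ 2 / (2 * (1 - 2 * b)) =
            a ^ 2 / 2 + a ^ 2 / (4 * ((1 - 2 * b) / (4 * b))) := by
          field_simp
          ring
        rw [h2, h3, Real.exp_add]
        congr 1
        field_simp

/-- Freezing: a variable which is sub-Gaussian given `X` is dominated by the standard Gaussian
on exponentials of quadratics with coefficients depending on `X`. -/
lemma lintegral_mul_exp_quadratic_le {Ω β : Type*} {m0 : MeasurableSpace Ω}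
    [MeasurableSpace β] (P : Measure Ω) [IsFiniteMeasure P] {X : Ω → β} {η : Ω → ℝ}
    (hX : Measurable X) (hη : Measurable η)
    (hsg : ∀ u : ℝ, ∀ B, MeasurableSet B →
      ∫⁻ ω in X ⁻¹' B, ENNReal.ofReal (Real.exp (u * η ω)) ∂P ≤
        ENNReal.ofReal (Real.exp (u ^ 2 / 2)) * P (X ⁻¹' B))
    {g : β → ENNReal} (hg : Measurable g) {a b : β → ℝ} (ha : Measurable a)
    (hb : Measurable b) (hb0 : ∀ x, 0 ≤ b x) (hb1 : ∀ x, b x < 1 / 2) :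
    ∫⁻ ω, g (X ω) * ENNReal.ofReal (Real.exp (a (X ω) * η ω + b (X ω) * η ω ^ 2)) ∂P ≤
      ∫⁻ ω, g (X ω) * ENNReal.ofReal (Real.exp (a (X ω) ^ 2 / (2 * (1 - 2 * b (X ω)))) /
        Real.sqrt (1 - 2 * b (X ω))) ∂P := by
  set ρ : Measure (β × ℝ) := P.map fun ω => (X ω, η ω) with hρ
  have hpair : Measurable fun ω => (X ω, η ω) := hX.prodMk hη
  have hfst : ρ.fst = P.map X := Measure.fst_map_prodMk hη
  have hint : ∀ f : β × ℝ → ENNReal, Measurable f →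
      ∫⁻ ω, f (X ω, η ω) ∂P = ∫⁻ x, ∫⁻ y, f (x, y) ∂(ρ.condKernel x) ∂(P.map X) := by
    intro f hf
    rw [← hfst, ← Measure.lintegral_compProd hf, ρ.disintegrate, hρ, lintegral_map hf hpair]
  have hu : ∀ u : ℝ, ∀ᵐ x ∂(P.map X), ∫⁻ y, ENNReal.ofReal (Real.exp (u * y)) ∂(ρ.condKernel x)
      ≤ ENNReal.ofReal (Real.exp (u ^ 2 / 2)) := by
    intro u
    refine ae_le_of_forall_setLIntegral_le_of_sigmaFinite
      (Measurable.lintegral_kernel (by fun_prop)) fun B hB _ => ?_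
    have h1 := hint (fun z => B.indicator (fun _ => 1) z.1 * ENNReal.ofReal (Real.exp (u * z.2)))
      (((measurable_const.indicator hB).comp measurable_fst).mul (by fun_prop))
    have h2 := hsg u B hB
    rw [← lintegral_indicator (hX hB)] at h2
    rw [← lintegral_indicator hB, lintegral_const, Measure.restrict_apply_univ,
      Measure.map_apply hX hB]
    refine le_trans (le_of_eq ?_) h2
    convert h1.symm using 1
    · refine lintegral_congr fun x => ?_
      by_cases hx : x ∈ B <;> simp [hx]
    · refine lintegral_congr fun x => ?_
      by_cases hx : X x ∈ B <;> simp [hx]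
  have hall : ∀ᵐ x ∂(P.map X), ∀ u : ℝ,
      ∫⁻ y, ENNReal.ofReal (Real.exp (u * y)) ∂(ρ.condKernel x)
        ≤ ENNReal.ofReal (Real.exp (u ^ 2 / 2)) := by
    have hq : ∀ᵐ x ∂(P.map X), ∀ q : ℚ, _ := ae_all_iff.2 fun q : ℚ => hu q
    filter_upwards [hq] with x hx u
    obtain ⟨q, hqu⟩ : ∃ q : ℕ → ℚ, Filter.Tendsto (fun n => (q n : ℝ)) Filter.atTop (nhds u) := by
      obtain ⟨s, hs, hsu⟩ := mem_closure_iff_seq_limit.1 (Rat.denseRange_cast (𝕜 := ℝ) u)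
      choose q hq using hs
      exact ⟨q, by simpa [hq] using hsu⟩
    have hlim : ∀ y : ℝ, Filter.liminf (fun n => ENNReal.ofReal (Real.exp (q n * y))) Filter.atTop
        = ENNReal.ofReal (Real.exp (u * y)) := fun y =>
      (((ENNReal.continuous_ofReal.comp (by fun_prop : Continuous fun v : ℝ => Real.exp (v * y))).tendsto u).comp
        hqu).liminf_eq
    have hlim2 : Filter.liminf (fun n => ENNReal.ofReal (Real.exp ((q n : ℝ) ^ 2 / 2))) Filter.atTop
        = ENNReal.ofReal (Real.exp (u ^ 2 / 2)) :=
      (((ENNReal.continuous_ofReal.comp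
        (by fun_prop : Continuous fun v : ℝ => Real.exp (v ^ 2 / 2))).tendsto u).comp hqu).liminf_eq
    rw [← hlim2]
    simp_rw [← hlim]
    exact (lintegral_liminf_le fun n => by fun_prop).trans
      (Filter.liminf_le_liminf (Filter.Eventually.of_forall fun n => hx (q n)))
  rw [hint (fun z => g z.1 * ENNReal.ofReal (Real.exp (a z.1 * z.2 + b z.1 * z.2 ^ 2)))
    (by fun_prop), ← lintegral_map (f := fun x => g x * ENNReal.ofReal
      (Real.exp (a x ^ 2 / (2 * (1 - 2 * b x))) / Real.sqrt (1 - 2 * b x))) (by fun_prop) hX]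
  refine lintegral_mono_ae ?_
  filter_upwards [hall] with x hx
  rw [lintegral_const_mul _ (by fun_prop)]
  gcongr
  exact lintegral_exp_quadratic_le_of_subgaussian _ hx (a x) (hb0 x) (hb1 x)

/-- Ville's inequality at a finite horizon for nonnegative supermartingales. -/
lemma mul_measure_exists_lt_le_of_setLIntegral_le {Ω : Type*} {m0 : MeasurableSpace Ω}
    (P : Measure Ω) (F : Filtration ℕ m0) {N : ℕ → Ω → ENNReal}
    (hN : ∀ t, Measurable[F t] (N t))
    (hsuper : ∀ t B, MeasurableSet[F t] B → ∫⁻ ω in B, N (t + 1) ω ∂P ≤ ∫⁻ ω in B, N t ω ∂P)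
    (c : ENNReal) (T : ℕ) :
    c * P {ω | ∃ t ≤ T, c < N t ω} ≤ ∫⁻ ω, N 0 ω ∂P := by
  have hgt : ∀ t, MeasurableSet[F t] {ω | c < N t ω} := fun t =>
    hN t measurableSet_Ioi
  have hG : ∀ T, MeasurableSet[F T] {ω | ∃ t ≤ T, c < N t ω} := fun T => by
    have : {ω | ∃ t ≤ T, c < N t ω} = ⋃ t ∈ Set.Iic T, {ω | c < N t ω} := by
      ext ω; simp
    rw [this]
    exact MeasurableSet.biUnion (Set.to_countable _) fun t ht => F.mono ht _ (hgt t)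
  suffices h : ∀ T, c * P {ω | ∃ t ≤ T, c < N t ω} +
      ∫⁻ ω in {ω | ∃ t ≤ T, c < N t ω}ᶜ, N T ω ∂P ≤ ∫⁻ ω, N 0 ω ∂P from
    le_self_add.trans (h T)
  have hmarkov : ∀ t B, c * P ({ω | c < N t ω} ∩ B) ≤ ∫⁻ ω in {ω | c < N t ω} ∩ B, N t ω ∂P :=
    fun t B => by
      rw [← setLIntegral_const]
      exact setLIntegral_mono ((hN t).mono (F.le t) le_rfl) fun ω hω => hω.1.le
  intro T
  induction T with
  | zero =>
    have h := hmarkov 0 Set.univ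
    simp only [Set.inter_univ] at h
    simp only [Nat.le_zero, exists_eq_left]
    exact (add_le_add_left h _).trans_eq (lintegral_add_compl (N 0) (F.le 0 _ (hgt 0)))
  | succ T ih =>
    refine le_trans ?_ ih
    have hsplit : {ω | ∃ t ≤ T + 1, c < N t ω} = {ω | ∃ t ≤ T, c < N t ω} ∪
        ({ω | c < N (T + 1) ω} ∩ {ω | ∃ t ≤ T, c < N t ω}ᶜ) := by
      ext ω
      simp only [Set.mem_ofPred_eq, Set.mem_union, Set.mem_inter_iff, Set.mem_compl_iff,
        Nat.le_succ_iff_eq_or_le, or_and_right, exists_or, exists_eq_left, Nat.succ_eq_add_one]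
      by_cases h : ∃ t ≤ T, c < N t ω <;> simp [h]
    have hcompl : {ω | ∃ t ≤ T + 1, c < N t ω}ᶜ =
        {ω | ∃ t ≤ T, c < N t ω}ᶜ \ {ω | c < N (T + 1) ω} := by
      rw [hsplit]
      ext ω
      simp only [Set.mem_compl_iff, Set.mem_union, Set.mem_inter_iff, Set.mem_sdiff]
      tauto
    have hs := hsuper T _ (hG T).compl
    rw [← lintegral_inter_add_sdiff (N (T + 1)) {ω | ∃ t ≤ T, c < N t ω}ᶜ
      (F.le _ _ (hgt (T + 1)))] at hs
    have hm := hmarkov (T + 1) {ω | ∃ t ≤ T, c < N t ω}ᶜ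
    rw [hcompl]
    calc _ ≤ c * (P {ω | ∃ t ≤ T, c < N t ω} +
          P ({ω | c < N (T + 1) ω} ∩ {ω | ∃ t ≤ T, c < N t ω}ᶜ)) + _ := by
          gcongr
          rw [hsplit]
          exact measure_union_le _ _
      _ ≤ _ := by
          rw [mul_add, add_assoc]
          gcongr
          refine le_trans ?_ hs
          rw [Set.inter_comm] at hm ⊢
          gcongr

/-- The Sherman–Morrison update of an inverse quadratic form under a rank-one perturbation. -/
lemma dotProduct_inv_mulVec_rank_one_update {n : Type*} [Fintype n] [DecidableEq n]
    {V : Matrix n n ℝ} (hV : V.PosDef) (a y : n → ℝ) {w : ℝ} (hw : 0 ≤ w) (e : ℝ) :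
    (y + (w * e) • a) ⬝ᵥ (V + w • vecMulVec a a)⁻¹ *ᵥ (y + (w * e) • a) =
      y ⬝ᵥ V⁻¹ *ᵥ y + w * (2 * (a ⬝ᵥ V⁻¹ *ᵥ y) * e + w * (a ⬝ᵥ V⁻¹ *ᵥ a) * e ^ 2 -
        (a ⬝ᵥ V⁻¹ *ᵥ y) ^ 2) / (1 + w * (a ⬝ᵥ V⁻¹ *ᵥ a)) := by
  have hq : 0 ≤ a ⬝ᵥ V⁻¹ *ᵥ a := by simpa using hV.inv.posSemidef.dotProduct_mulVec_nonneg a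
  have hs : 1 + w * (a ⬝ᵥ V⁻¹ *ᵥ a) ≠ 0 := by positivity
  have hsymm : y ⬝ᵥ V⁻¹ *ᵥ a = a ⬝ᵥ V⁻¹ *ᵥ y := by
    have hT : V⁻¹ᵀ = V⁻¹ := by simpa using hV.inv.isHermitian.eq
    rw [dotProduct_mulVec, ← mulVec_transpose, hT, dotProduct_comm]
  have hV' : (V + w • vecMulVec a a).PosDef :=
    hV.add_posSemidef ((by simpa using posSemidef_vecMulVec_self_star a :
      (vecMulVec a a).PosSemidef).smul hw)
  have hVdet : IsUnit V.det := hV.det_pos.ne'.isUnit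
  have hV'det : IsUnit (V + w • vecMulVec a a).det := hV'.det_pos.ne'.isUnit
  set p := a ⬝ᵥ V⁻¹ *ᵥ y with hp
  set q := a ⬝ᵥ V⁻¹ *ᵥ a with hqdef
  have hsolve : (V + w • vecMulVec a a) *ᵥ (V⁻¹ *ᵥ y +
      (w * e - w * (p + w * e * q) / (1 + w * q)) • V⁻¹ *ᵥ a) = y + (w * e) • a := by
    rw [add_mulVec, mulVec_add, mulVec_smul, mulVec_mulVec, mulVec_mulVec,
      mul_nonsing_inv _ hVdet, one_mulVec, one_mulVec, smul_mulVec, vecMulVec_mulVec,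
      dotProduct_add, dotProduct_smul, ← hp, ← hqdef]
    ext i
    simp only [Pi.add_apply, Pi.smul_apply, smul_eq_mul, MulOpposite.smul_eq_mul_unop,
      MulOpposite.unop_op]
    field_simp
    ring
  rw [← hsolve, mulVec_mulVec, nonsing_inv_mul _ hV'det, one_mulVec, hsolve]
  simp only [add_dotProduct, dotProduct_add, smul_dotProduct, dotProduct_smul, smul_eq_mul,
    hsymm, ← hp, ← hqdef]
  field_simp
  ring

/-- The matrix determinant lemma for a symmetric rank-one perturbation. -/
lemma det_add_smul_vecMulVec_self {n : Type*} [Fintype n] [DecidableEq n]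
    {V : Matrix n n ℝ} (hV : IsUnit V.det) (a : n → ℝ) (w : ℝ) :
    (V + w • vecMulVec a a).det = V.det * (1 + w * (a ⬝ᵥ V⁻¹ *ᵥ a)) := by
  have := det_add_replicateCol_mul_replicateRow (ι := Unit) hV (w • a) a
  rw [← vecMulVec_eq, smul_vecMulVec] at this
  rw [this, det_unique (1 + _), Matrix.add_apply, Matrix.mul_assoc]
  congr 2
  simp only [replicateCol_smul, Matrix.mul_smul, Matrix.smul_apply, smul_eq_mul]
  rfl

/-- One step of the supermartingale property of the self-normalized exponential process. -/
lemma lintegral_mul_exp_self_normalized_le {Ω β : Type*} {m0 : MeasurableSpace Ω}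
    [MeasurableSpace β] (P : Measure Ω) [IsFiniteMeasure P] {X : Ω → β} {η : Ω → ℝ}
    (hX : Measurable X) (hη : Measurable η)
    (hsg : ∀ u : ℝ, ∀ B, MeasurableSet B →
      ∫⁻ ω in X ⁻¹' B, ENNReal.ofReal (Real.exp (u * η ω)) ∂P ≤
        ENNReal.ofReal (Real.exp (u ^ 2 / 2)) * P (X ⁻¹' B))
    {N : β → ENNReal} (hN : Measurable N) {p s c : β → ℝ} (hp : Measurable p)
    (hs : Measurable s) (hc : Measurable c) (hs1 : ∀ x, 1 ≤ s x) (hc0 : ∀ x, 0 ≤ c x)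
    (hc1 : ∀ x, c x ≤ 1) :
    ∫⁻ ω, N (X ω) * ENNReal.ofReal (Real.exp (c (X ω) * (2 * p (X ω) * η ω +
        (s (X ω) - 1) * η ω ^ 2 - p (X ω) ^ 2) / (2 * s (X ω))) / Real.sqrt (s (X ω))) ∂P ≤
      ∫⁻ ω, N (X ω) ∂P := by
  have hs0 : ∀ x, 0 < s x := fun x => one_pos.trans_le (hs1 x)
  have hcs : ∀ x, 0 ≤ (1 - c x) * (s x - 1) := fun x =>
    mul_nonneg (sub_nonneg.2 (hc1 x)) (sub_nonneg.2 (hs1 x))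
  have hb : ∀ x, 1 - 2 * (c x * (s x - 1) / (2 * s x)) = (1 + (1 - c x) * (s x - 1)) / s x :=
    fun x => by
      have := (hs0 x).ne'
      field_simp
      ring
  have key := lintegral_mul_exp_quadratic_le P hX hη hsg
    (g := fun x => N x * ENNReal.ofReal (Real.exp (-(c x * p x ^ 2 / (2 * s x))) / Real.sqrt (s x)))
    (a := fun x => c x * p x / s x) (b := fun x => c x * (s x - 1) / (2 * s x))
    (by fun_prop) (by fun_prop) (by fun_prop)
    (fun x => div_nonneg (mul_nonneg (hc0 x) (sub_nonneg.2 (hs1 x))) (by linarith [hs0 x]))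
    (fun x => by
      have h : 0 < (1 + (1 - c x) * (s x - 1)) / s x :=
        div_pos (by linarith [hcs x]) (hs0 x)
      linarith [hb x])
  refine le_trans (le_of_eq ?_) (key.trans ?_)
  · refine lintegral_congr fun ω => ?_
    have := (hs0 (X ω)).ne'
    rw [mul_assoc (N (X ω)) (ENNReal.ofReal _), ← ENNReal.ofReal_mul (by positivity), div_mul_eq_mul_div, ← Real.exp_add]
    congr 4
    field_simp
    ring
  · refine lintegral_mono fun ω => ?_
    generalize X ω = x
    rw [mul_assoc, ← ENNReal.ofReal_mul (by positivity)]
    refine mul_le_of_le_one_right' (ENNReal.ofReal_le_one.2 ?_)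
    have hs0 := hs0 x
    have hr : 0 < 1 + (1 - c x) * (s x - 1) := by linarith [hcs x]
    rw [hb, div_mul_div_comm, ← Real.exp_add, ← Real.sqrt_mul hs0.le,
      mul_div_cancel₀ _ hs0.ne']
    refine div_le_one_of_le₀ ?_ (Real.sqrt_nonneg _)
    have h1 : 1 ≤ Real.sqrt (1 + (1 - c x) * (s x - 1)) :=
      Real.one_le_sqrt.2 (by linarith [hcs x])
    refine le_trans (Real.exp_le_one_iff.2 ?_) h1
    have h2 : -(c x * p x ^ 2 / (2 * s x)) + (c x * p x / s x) ^ 2 /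
        (2 * ((1 + (1 - c x) * (s x - 1)) / s x)) =
        -(c x * p x ^ 2 * ((1 - c x) * s x)) / (2 * s x * (1 + (1 - c x) * (s x - 1))) := by
      field_simp
      ring
    rw [h2]
    refine div_nonpos_of_nonpos_of_nonneg (neg_nonpos.2 ?_) (by positivity)
    have := hc0 x
    have := sub_nonneg.2 (hc1 x)
    positivity

/-- A conditionally sub-Gaussian variable satisfies the sub-Gaussian bound on every event of the
conditioning σ-algebra. -/
lemma setLIntegral_exp_le_of_condExp_le {Ω : Type*} {m m0 : MeasurableSpace Ω}
    (P : Measure Ω) [IsFiniteMeasure P] (hm : m ≤ m0) {η : Ω → ℝ} {u C : ℝ} (hC : 0 ≤ C)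
    (hint : Integrable (fun ω => Real.exp (u * η ω)) P)
    (hsg : (P[fun ω => Real.exp (u * η ω)|m]) ≤ᵐ[P] fun _ => C)
    {B : Set Ω} (hB : MeasurableSet[m] B) :
    ∫⁻ ω in B, ENNReal.ofReal (Real.exp (u * η ω)) ∂P ≤ ENNReal.ofReal C * P B := by
  rw [← ofReal_integral_eq_lintegral_ofReal hint.integrableOn
    (Filter.Eventually.of_forall fun ω => (Real.exp_pos _).le), ← setIntegral_condExp hm hint hB]
  have h := setIntegral_mono_ae (s := B) integrable_condExp.integrableOn
    (integrable_const C).integrableOn hsg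
  refine (ENNReal.ofReal_le_ofReal h).trans_eq ?_
  rw [setIntegral_const, smul_eq_mul, mul_comm, ENNReal.ofReal_mul hC, measureReal_def,
    ENNReal.ofReal_toReal (measure_ne_top _ _)]

/-- Inverse bilinear forms of random matrices are measurable. -/
lemma MeasureTheory.StronglyMeasurable.measurable_dotProduct_inv_mulVec {Ω n : Type*} [Fintype n]
    [DecidableEq n] {m : MeasurableSpace Ω} {V : Ω → Matrix n n ℝ} {y z : Ω → n → ℝ}
    (hV : StronglyMeasurable V) (hy : StronglyMeasurable y) (hz : StronglyMeasurable z) :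
    Measurable fun ω => y ω ⬝ᵥ (V ω)⁻¹ *ᵥ z ω := by
  simp_rw [Matrix.inv_def, Ring.inverse_eq_inv', smul_mulVec, dotProduct_smul, smul_eq_mul]
  refine Measurable.mul (Measurable.inv ?_) ?_
  · exact ((continuous_id.matrix_det).comp_stronglyMeasurable hV).measurable
  · have hc : Continuous fun x : (n → ℝ) × Matrix n n ℝ × (n → ℝ) =>
        x.1 ⬝ᵥ x.2.1.adjugate *ᵥ x.2.2 :=
      continuous_fst.dotProduct
        (continuous_snd.fst.matrix_adjugate.matrix_mulVec continuous_snd.snd)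
    exact (hc.comp_stronglyMeasurable (hy.prodMk (hV.prodMk hz))).measurable

/-- Self-normalized martingale tail (Lemma 2): with probability at least
`1 − δ`, simultaneously for all `t ≤ T`,
`Y_tᵀ V_t⁻¹ Y_t ≤ 2μ ln( det(V_t)^{1/2} / (det(λI)^{1/2} δ) )`. -/
theorem self_normalized_martingale_tail
    {Ω : Type*} {m0 : MeasurableSpace Ω} (P : Measure Ω) [IsProbabilityMeasure P]
    (F : Filtration ℕ m0)
    (D : ℕ) (hD : 0 < D) (lam eps mu δ : ℝ)
    (hlam : 0 < lam) (heps : 0 < eps) (hem : eps ≤ mu)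
    (hδ : δ ∈ Set.Ioo (0 : ℝ) 1) (T : ℕ)
    (A : ℕ → Ω → Fin D → ℝ) (w : ℕ → Ω → ℝ) (η : ℕ → Ω → ℝ)
    (hAmeas : ∀ t, 1 ≤ t → Measurable[F (t - 1)] (A t))
    (hwmeas : ∀ t, 1 ≤ t → Measurable[F (t - 1)] (w t))
    (hwbound : ∀ t ω, w t ω ∈ Set.Icc eps mu)
    (hηadapted : ∀ t, Measurable[F t] (η t))
    (hηint : ∀ t (u : ℝ), Integrable (fun ω => Real.exp (u * η t ω)) P)
    (hηsg : ∀ t, 1 ≤ t → ∀ u : ℝ,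
      (P[fun ω => Real.exp (u * η t ω)|F (t - 1)]) ≤ᵐ[P] fun _ => Real.exp (u ^ 2 / 2))
    (Y : ℕ → Ω → Fin D → ℝ)
    (hY : ∀ t ω, Y t ω = ∑ s ∈ Icc 1 t, (w s ω * η s ω) • A s ω)
    (V : ℕ → Ω → Matrix (Fin D) (Fin D) ℝ)
    (hV : ∀ t ω, V t ω = lam • (1 : Matrix (Fin D) (Fin D) ℝ)
        + ∑ s ∈ Icc 1 t, w s ω • vecMulVec (A s ω) (A s ω)) :
    ENNReal.ofReal (1 - δ) ≤
      P {ω | ∀ t ≤ T,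
        Y t ω ⬝ᵥ (V t ω)⁻¹ *ᵥ Y t ω
          ≤ 2 * mu * Real.log (Real.sqrt (V t ω).det /
              (Real.sqrt (lam • (1 : Matrix (Fin D) (Fin D) ℝ)).det * δ))} := by
  have hmu : 0 < mu := heps.trans_le hem
  have hw0 : ∀ t ω, 0 ≤ w t ω := fun t ω => heps.le.trans (hwbound t ω).1
  have hwm : ∀ {s i}, 1 ≤ s → s ≤ i + 1 → StronglyMeasurable[F i] (w s) := fun {s i} hs hi =>
    ((hwmeas s hs).mono (F.mono (by omega)) le_rfl).stronglyMeasurable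
  have hAm : ∀ {s i}, 1 ≤ s → s ≤ i + 1 → StronglyMeasurable[F i] (A s) := fun {s i} hs hi =>
    ((hAmeas s hs).mono (F.mono (by omega)) le_rfl).stronglyMeasurable
  have hVm : ∀ {t i}, t ≤ i + 1 → StronglyMeasurable[F i] (V t) := fun {t i} hi => by
    rw [funext (hV t)]
    refine stronglyMeasurable_const.add (Finset.stronglyMeasurable_fun_sum _ fun s hs => ?_)
    rw [Finset.mem_Icc] at hs
    have hc : Continuous fun z : ℝ × (Fin D → ℝ) => z.1 • vecMulVec z.2 z.2 :=
      continuous_fst.smul (continuous_snd.matrix_vecMulVec continuous_snd)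
    exact hc.comp_stronglyMeasurable
      ((hwm hs.1 (hs.2.trans hi)).prodMk (hAm hs.1 (hs.2.trans hi)))
  have hYm : ∀ t, StronglyMeasurable[F t] (Y t) := fun t => by
    rw [funext (hY t)]
    refine Finset.stronglyMeasurable_fun_sum _ fun s hs => ?_
    rw [Finset.mem_Icc] at hs
    exact ((hwm hs.1 (by omega)).mul
      ((hηadapted s).mono (F.mono hs.2) le_rfl).stronglyMeasurable).smul (hAm hs.1 (by omega))
  have hdetm : ∀ {t i}, t ≤ i + 1 → Measurable[F i] fun ω => (V t ω).det := fun hi =>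
    ((continuous_id.matrix_det).comp_stronglyMeasurable (hVm hi)).measurable
  have hVsucc : ∀ t ω, V (t + 1) ω =
      V t ω + w (t + 1) ω • vecMulVec (A (t + 1) ω) (A (t + 1) ω) := fun t ω => by
    rw [hV, hV, Finset.sum_Icc_succ_top (by omega), add_assoc]
  have hYsucc : ∀ t ω, Y (t + 1) ω =
      Y t ω + (w (t + 1) ω * η (t + 1) ω) • A (t + 1) ω := fun t ω => by
    rw [hY, hY, Finset.sum_Icc_succ_top (by omega)]
  have hVpos : ∀ t ω, (V t ω).PosDef := fun t ω => by
    rw [hV]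
    refine (PosDef.one.smul hlam).add_posSemidef (posSemidef_sum _ fun s _ => ?_)
    exact (by simpa using posSemidef_vecMulVec_self_star (A s ω) :
      (vecMulVec (A s ω) (A s ω)).PosSemidef).smul (hw0 s ω)
  have hdet0 : 0 < (lam • (1 : Matrix (Fin D) (Fin D) ℝ)).det := (PosDef.one.smul hlam).det_pos
  set L := Real.sqrt (lam • (1 : Matrix (Fin D) (Fin D) ℝ)).det with hL
  have hLpos : 0 < L := Real.sqrt_pos.2 hdet0
  have hdetpos : ∀ t ω, 0 < Real.sqrt (V t ω).det := fun t ω =>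
    Real.sqrt_pos.2 (hVpos t ω).det_pos
  set N : ℕ → Ω → ENNReal := fun t ω => ENNReal.ofReal
    (L / Real.sqrt (V t ω).det * Real.exp (Y t ω ⬝ᵥ (V t ω)⁻¹ *ᵥ Y t ω / (2 * mu))) with hNdef
  have hNm : ∀ t, Measurable[F t] (N t) := fun t =>
    (((hdetm (Nat.le_succ t)).sqrt.const_div L).mul
      (((hVm (Nat.le_succ t)).measurable_dotProduct_inv_mulVec (hYm t) (hYm t)).div_const
        (2 * mu)).exp).ennreal_ofReal
  have hsuper : ∀ t B, MeasurableSet[F t] B →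
      ∫⁻ ω in B, N (t + 1) ω ∂P ≤ ∫⁻ ω in B, N t ω ∂P := fun t B hB => by
    have hAt := hAm (s := t + 1) (i := t) (by omega) le_rfl
    have hwt := (hwm (s := t + 1) (i := t) (by omega) le_rfl).measurable
    have hVt := hVm (Nat.le_succ t)
    have hq : ∀ ω, 0 ≤ A (t + 1) ω ⬝ᵥ (V t ω)⁻¹ *ᵥ A (t + 1) ω := fun ω => by
      simpa using (hVpos t ω).inv.posSemidef.dotProduct_mulVec_nonneg (A (t + 1) ω)
    have hstep := @lintegral_mul_exp_self_normalized_le Ω Ω m0 (F t) P _ id (η (t + 1))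
      (measurable_id'' (F.le t)) ((hηadapted (t + 1)).mono (F.le _) le_rfl)
      (fun u B hB => setLIntegral_exp_le_of_condExp_le P (F.le t) (Real.exp_pos _).le
        (hηint (t + 1) u) (hηsg (t + 1) (by omega) u) hB)
      (B.indicator (N t)) ((hNm t).indicator hB)
      (fun ω => A (t + 1) ω ⬝ᵥ (V t ω)⁻¹ *ᵥ Y t ω)
      (fun ω => 1 + w (t + 1) ω * (A (t + 1) ω ⬝ᵥ (V t ω)⁻¹ *ᵥ A (t + 1) ω))
      (fun ω => w (t + 1) ω / mu)
      (hVt.measurable_dotProduct_inv_mulVec hAt (hYm t))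
      ((hwt.mul (hVt.measurable_dotProduct_inv_mulVec hAt hAt)).const_add 1)
      (hwt.div_const mu)
      (fun ω => le_add_of_nonneg_right (mul_nonneg (hw0 _ ω) (hq ω)))
      (fun ω => div_nonneg (hw0 _ ω) hmu.le)
      (fun ω => div_le_one_of_le₀ (hwbound _ ω).2 hmu.le)
    rw [← lintegral_indicator (F.le t _ hB), ← lintegral_indicator (F.le t _ hB)]
    refine le_trans (le_of_eq (lintegral_congr fun ω => ?_)) hstep
    by_cases hω : ω ∈ B
    · have hs : 0 < 1 + w (t + 1) ω * (A (t + 1) ω ⬝ᵥ (V t ω)⁻¹ *ᵥ A (t + 1) ω) :=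
        add_pos_of_pos_of_nonneg one_pos (mul_nonneg (hw0 _ ω) (hq ω))
      have hd := hdetpos t ω
      simp only [id, Set.indicator_of_mem hω, hNdef]
      rw [← ENNReal.ofReal_mul (by positivity), hYsucc, hVsucc,
        dotProduct_inv_mulVec_rank_one_update (hVpos t ω) _ _ (hw0 _ ω),
        det_add_smul_vecMulVec_self (hVpos t ω).det_pos.ne'.isUnit,
        Real.sqrt_mul (hVpos t ω).det_pos.le, add_div, Real.exp_add]
      generalize A (t + 1) ω ⬝ᵥ (V t ω)⁻¹ *ᵥ A (t + 1) ω = q at hs ⊢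
      have hexp : ∀ p e W : ℝ, W * (2 * p * e + W * q * e ^ 2 - p ^ 2) / (1 + W * q) / (2 * mu) =
          W / mu * (2 * p * e + (1 + W * q - 1) * e ^ 2 - p ^ 2) / (2 * (1 + W * q)) :=
        fun p e W => by
          rw [add_sub_cancel_left, div_div, div_mul_eq_mul_div, div_div]
          congr 1
          ring
      rw [hexp]
      congr 1
      have := Real.sqrt_pos.2 hs
      field_simp
    · simp [hω]
  have hVille := mul_measure_exists_lt_le_of_setLIntegral_le P F hNm hsuper
    (ENNReal.ofReal δ⁻¹) T
  have hN0 : ∫⁻ ω, N 0 ω ∂P = 1 := by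
    have h0 : ∀ ω, N 0 ω = 1 := fun ω => by
      have hY0 : Y 0 ω = 0 := by simp [hY]
      have hV0 : V 0 ω = lam • 1 := by simp [hV]
      simp only [hNdef, hY0, hV0, zero_dotProduct, zero_div, Real.exp_zero, mul_one, ← hL,
        div_self hLpos.ne', ENNReal.ofReal_one]
    simp [h0]
  rw [hN0] at hVille
  have hbad : {ω | ∃ t ≤ T, ENNReal.ofReal δ⁻¹ < N t ω}ᶜ = {ω | ∀ t ≤ T,
      Y t ω ⬝ᵥ (V t ω)⁻¹ *ᵥ Y t ω ≤ 2 * mu * Real.log (Real.sqrt (V t ω).det / (L * δ))} := by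
    ext ω
    simp only [Set.mem_compl_iff, Set.mem_ofPred_eq, not_exists, not_and, not_lt, hNdef]
    refine forall₂_congr fun t _ => ?_
    have hd := hdetpos t ω
    have hδ0 := hδ.1
    rw [ENNReal.ofReal_le_ofReal_iff (by positivity), ← div_le_iff₀' (by positivity),
      Real.le_log_iff_exp_le (by positivity), ← le_div_iff₀' (by positivity)]
    congr! 1
    field_simp
  have hmeas : MeasurableSet {ω | ∃ t ≤ T, ENNReal.ofReal δ⁻¹ < N t ω} := by
    have : {ω | ∃ t ≤ T, ENNReal.ofReal δ⁻¹ < N t ω} =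
        ⋃ t ∈ Set.Iic T, {ω | ENNReal.ofReal δ⁻¹ < N t ω} := by
      ext ω; simp
    rw [this]
    exact MeasurableSet.biUnion (Set.to_countable _) fun t _ =>
      F.le t _ (hNm t measurableSet_Ioi)
  rw [← hbad, prob_compl_eq_one_sub hmeas, ENNReal.ofReal_sub _ hδ.1.le, ENNReal.ofReal_one]
  refine tsub_le_tsub_left ?_ 1
  rw [ENNReal.ofReal_inv_of_pos hδ.1] at hVille ⊢
  have hδe : ENNReal.ofReal δ ≠ 0 := by simpa using hδ.1
  simpa using (ENNReal.inv_mul_le_iff hδe ENNReal.ofReal_ne_top).1 hVille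
end

section
/- Weighted elliptical potential lemma (Lemma 3, first inequality): Let D be a positive integer, λ > 0, V_0 = λI, and for t = 1, …, T set V_t = V_{t-1} + w_t A_t A_tᵀ, where A_t ∈ ℝ^D and w_t ∈ [ε, μ] with 0 < ε ≤ μ. Then Σ_{t=1}^T min{ 1, w_t · A_tᵀ V_{t-1}^{-1} A_t } ≤ 2 · ln( det(V_T) / det(V_0) ). -/
open Matrix Finset

theorem min_one_le_two_mul_log_one_add {z : ℝ} (hz : 0 ≤ z) :
    min 1 z ≤ 2 * Real.log (1 + z) := by
  have hlog := Real.le_log_one_add_of_nonneg hz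
  suffices h : min 1 z ≤ 2 * (2 * z / (z + 2)) by linarith
  rw [← mul_div_assoc, le_div_iff₀ (by linarith)]
  rcases le_total 1 z with h | h
  · rw [min_eq_left h]
    linarith
  · rw [min_eq_right h]
    nlinarith

theorem Matrix.det_add_smul_vecMulVec {n R : Type*} [Fintype n] [DecidableEq n] [CommRing R]
    {M : Matrix n n R} (hM : IsUnit M.det) (c : R) (a b : n → R) :
    (M + c • vecMulVec a b).det = M.det * (1 + c * (b ⬝ᵥ M⁻¹ *ᵥ a)) := by
  rw [← smul_vecMulVec, vecMulVec_eq Unit, det_add_replicateCol_mul_replicateRow hM,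
    det_unique (n := Unit), Matrix.mul_assoc, ← replicateCol_mulVec, mulVec_smul]
  simp [Matrix.mul_apply, dotProduct, mul_sum]

theorem Matrix.PosDef.add_smul_vecMulVec_self {n : Type*} [Fintype n]
    {M : Matrix n n ℝ} (hM : M.PosDef) {c : ℝ} (hc : 0 ≤ c) (a : n → ℝ) :
    (M + c • vecMulVec a a).PosDef := by
  have ha : (vecMulVec a a).PosSemidef := by simpa using posSemidef_vecMulVec_self_star a
  exact hM.add_posSemidef (ha.smul hc)

/-- Weighted elliptical potential lemma (Lemma 3, first inequality). -/
theorem weighted_elliptical_potential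
    (D T : ℕ) (hD : 0 < D) (lam eps mu : ℝ)
    (hlam : 0 < lam) (heps : 0 < eps) (hem : eps ≤ mu)
    (A : ℕ → Fin D → ℝ) (w : ℕ → ℝ) (hw : ∀ t, w t ∈ Set.Icc eps mu)
    (V : ℕ → Matrix (Fin D) (Fin D) ℝ)
    (hV0 : V 0 = lam • (1 : Matrix (Fin D) (Fin D) ℝ))
    (hVt : ∀ t : ℕ, V (t + 1) = V t + w (t + 1) • vecMulVec (A (t + 1)) (A (t + 1))) :
    ∑ t ∈ Icc 1 T, min 1 (w t * (A t ⬝ᵥ (V (t - 1))⁻¹ *ᵥ A t))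
      ≤ 2 * Real.log ((V T).det / (V 0).det) := by
  have hw0 : ∀ t, 0 ≤ w t := fun t => heps.le.trans (hw t).1
  have hpos : ∀ t, (V t).PosDef := by
    intro t
    induction t with
    | zero => exact hV0 ▸ PosDef.one.smul hlam
    | succ t ih => exact hVt t ▸ ih.add_smul_vecMulVec_self (hw0 _) _
  have hdet : ∀ t, 0 < (V t).det := fun t => (hpos t).det_pos
  induction T with
  | zero => simp [(hdet 0).ne']
  | succ T ih =>
    rw [sum_Icc_succ_top (by lia), Nat.add_sub_cancel]
    set z := w (T + 1) * (A (T + 1) ⬝ᵥ (V T)⁻¹ *ᵥ A (T + 1)) with hz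
    have hz0 : 0 ≤ z :=
      mul_nonneg (hw0 _) (by
        simpa using (hpos T).inv.posSemidef.dotProduct_mulVec_nonneg (A (T + 1)))
    have hstep : (V (T + 1)).det / (V 0).det = (V T).det / (V 0).det * (1 + z) := by
      rw [hVt T, det_add_smul_vecMulVec (hdet T).ne'.isUnit, ← hz, mul_div_right_comm]
    rw [hstep, Real.log_mul (div_pos (hdet T) (hdet 0)).ne' (by positivity), mul_add]
    exact add_le_add ih (min_one_le_two_mul_log_one_add hz0)
end

section
/- Submodularity of the LinUCT objective (Theorem 2): Let n, d be positive integers, D = n·d, λ > 0, and let 𝒜 ⊂ ℝ^D be the finite set of all n-hot vectors. Let θ ∈ ℝ^D satisfy ⟨a, θ⟩ ≥ 0 for all a ∈ 𝒜. For a finite set S ⊆ 𝒜 define V(S) = λI + Σ_{a∈S} a aᵀ and Ψ(S) = Σ_{a∈S} ⟨a, θ⟩ + Σ_{a∈S} sqrt( aᵀ V(S)^{-1} a ). Assume that for every finite S ⊆ 𝒜 and every v ∈ S one has sqrt(vᵀ V(S)^{-1} v) ≤ 1/|S|. Then Ψ is (i) non-negative: Ψ(S) ≥ 0; (ii) monotone: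 Ψ(S) ≤ Ψ(S ∪ {a}) for all S ⊆ 𝒜 and a ∈ 𝒜; and (iii) submodular: for all S ⊆ T ⊆ 𝒜 and all a ∈ 𝒜 \ T, Ψ(S ∪ {a}) − Ψ(S) ≥ Ψ(T ∪ {a}) − Ψ(T). -/
open Matrix Finset

/-- An `n`-hot vector in `ℝ^{n×d}`: in each of the `n` blocks of dimension `d`
there is exactly one entry equal to `1`, and all other entries are `0`. -/
def nHot (n d : ℕ) (a : Fin n × Fin d → ℝ) : Prop :=
  ∀ i : Fin n, ∃ j : Fin d, a (i, j) = 1 ∧ ∀ j' : Fin d, j' ≠ j → a (i, j') = 0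

/-- The design matrix `V(S) = λI + Σ_{a∈S} a aᵀ`. -/
noncomputable def designMat (n d : ℕ) (lam : ℝ) (S : Finset (Fin n × Fin d → ℝ)) :
    Matrix (Fin n × Fin d) (Fin n × Fin d) ℝ :=
  lam • (1 : Matrix (Fin n × Fin d) (Fin n × Fin d) ℝ) + ∑ a ∈ S, vecMulVec a a

/-- The LinUCT objective `Ψ(S) = Σ_{a∈S} ⟨a,θ⟩ + Σ_{a∈S} ‖a‖_{V(S)⁻¹}`. -/
noncomputable def Psi (n d : ℕ) (lam : ℝ) (θ : Fin n × Fin d → ℝ)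
    (S : Finset (Fin n × Fin d → ℝ)) : ℝ :=
  ∑ a ∈ S, a ⬝ᵥ θ + ∑ a ∈ S, Real.sqrt (a ⬝ᵥ (designMat n d lam S)⁻¹ *ᵥ a)

/-- The bilinear form `(x, y) ↦ xᵀ V(S)⁻¹ y`. -/
noncomputable def invForm (n d : ℕ) (lam : ℝ) (S : Finset (Fin n × Fin d → ℝ))
    (x y : Fin n × Fin d → ℝ) : ℝ :=
  x ⬝ᵥ (designMat n d lam S)⁻¹ *ᵥ y

section QuadraticForms

variable {ι : Type*} [Fintype ι]

theorem dotProduct_mulVec_comm_of_isHermitian {G : Matrix ι ι ℝ} (hG : G.IsHermitian)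
    (x y : ι → ℝ) : x ⬝ᵥ G *ᵥ y = y ⬝ᵥ G *ᵥ x := by
  have hT : Gᵀ = G := by simpa [IsHermitian, conjTranspose_eq_transpose_of_trivial] using hG
  rw [dotProduct_mulVec, ← mulVec_transpose, hT, dotProduct_comm]

theorem sq_dotProduct_mulVec_le {G : Matrix ι ι ℝ} (hG : G.PosSemidef) (x y : ι → ℝ) :
    (x ⬝ᵥ G *ᵥ y) ^ 2 ≤ (x ⬝ᵥ G *ᵥ x) * (y ⬝ᵥ G *ᵥ y) := by
  have h := discrim_le_zero (a := y ⬝ᵥ G *ᵥ y) (b := 2 * (x ⬝ᵥ G *ᵥ y))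
    (c := x ⬝ᵥ G *ᵥ x) fun t => by
      have h0 : 0 ≤ (x + t • y) ⬝ᵥ G *ᵥ (x + t • y) := by
        simpa using hG.dotProduct_mulVec_nonneg (x + t • y)
      simp only [mulVec_add, mulVec_smul, dotProduct_add, add_dotProduct, smul_dotProduct,
        dotProduct_smul, smul_eq_mul, dotProduct_mulVec_comm_of_isHermitian hG.1 y x] at h0
      linarith
  unfold discrim at h
  linarith

/-- The Sherman–Morrison formula for a symmetric rank-one update. -/
theorem dotProduct_inv_add_vecMulVec_mulVec [DecidableEq ι] {M : Matrix ι ι ℝ} (hM : M.PosDef)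
    (a x y : ι → ℝ) :
    x ⬝ᵥ (M + vecMulVec a a)⁻¹ *ᵥ y = x ⬝ᵥ M⁻¹ *ᵥ y -
      (x ⬝ᵥ M⁻¹ *ᵥ a) * (a ⬝ᵥ M⁻¹ *ᵥ y) / (1 + a ⬝ᵥ M⁻¹ *ᵥ a) := by
  have hpos : 0 ≤ a ⬝ᵥ M⁻¹ *ᵥ a := by
    simpa using hM.inv.posSemidef.dotProduct_mulVec_nonneg a
  have hα : 1 + a ⬝ᵥ M⁻¹ *ᵥ a ≠ 0 := by positivity
  have hdet : IsUnit M.det := (isUnit_iff_isUnit_det M).1 hM.isUnit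
  have hinv : (M + vecMulVec a a)⁻¹ =
      M⁻¹ - (1 + a ⬝ᵥ M⁻¹ *ᵥ a)⁻¹ • vecMulVec (M⁻¹ *ᵥ a) (a ᵥ* M⁻¹) := by
    apply inv_eq_right_inv
    rw [mul_sub, add_mul, mul_nonsing_inv _ hdet, mul_smul_comm, add_mul, mul_vecMulVec,
      mulVec_mulVec, mul_nonsing_inv _ hdet, one_mulVec, vecMulVec_mul_vecMulVec,
      vecMulVec_mul, vecMulVec_smul]
    nth_rw 2 [← one_smul ℝ (vecMulVec a (a ᵥ* M⁻¹))]
    rw [← add_smul, smul_smul, inv_mul_cancel₀ hα, one_smul, add_sub_cancel_right]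
  rw [hinv, sub_mulVec, dotProduct_sub, smul_mulVec, dotProduct_smul, vecMulVec_mulVec,
    ← dotProduct_mulVec]
  simp only [op_smul_eq_smul, dotProduct_smul, smul_eq_mul]
  ring

end QuadraticForms

section InvForm

variable {n d : ℕ} {lam : ℝ}

theorem designMat_posDef (hlam : 0 < lam) (S : Finset (Fin n × Fin d → ℝ)) :
    (designMat n d lam S).PosDef := by
  unfold designMat
  refine (PosDef.one.smul hlam).add_posSemidef (posSemidef_sum _ fun a _ => ?_)
  simpa using posSemidef_vecMulVec_self_star a

theorem invForm_comm (hlam : 0 < lam) (S : Finset (Fin n × Fin d → ℝ))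
    (x y : Fin n × Fin d → ℝ) : invForm n d lam S x y = invForm n d lam S y x :=
  dotProduct_mulVec_comm_of_isHermitian (designMat_posDef hlam S).inv.1 x y

theorem invForm_self_nonneg (hlam : 0 < lam) (S : Finset (Fin n × Fin d → ℝ))
    (x : Fin n × Fin d → ℝ) : 0 ≤ invForm n d lam S x x := by
  simpa [invForm] using (designMat_posDef hlam S).inv.posSemidef.dotProduct_mulVec_nonneg x

theorem sq_invForm_le (hlam : 0 < lam) (S : Finset (Fin n × Fin d → ℝ))
    (x y : Fin n × Fin d → ℝ) :
    invForm n d lam S x y ^ 2 ≤ invForm n d lam S x x * invForm n d lam S y y :=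
  sq_dotProduct_mulVec_le (designMat_posDef hlam S).inv.posSemidef x y

theorem invForm_insert (hlam : 0 < lam) {S : Finset (Fin n × Fin d → ℝ)}
    {a : Fin n × Fin d → ℝ} (ha : a ∉ S) (x y : Fin n × Fin d → ℝ) :
    invForm n d lam (insert a S) x y = invForm n d lam S x y -
      invForm n d lam S x a * invForm n d lam S a y / (1 + invForm n d lam S a a) := by
  have h : designMat n d lam (insert a S) = designMat n d lam S + vecMulVec a a := by
    rw [designMat, designMat, sum_insert ha]
    abel
  rw [invForm, h]
  exact dotProduct_inv_add_vecMulVec_mulVec (designMat_posDef hlam S) a x y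

theorem psi_eq (θ : Fin n × Fin d → ℝ) (S : Finset (Fin n × Fin d → ℝ)) :
    Psi n d lam θ S = ∑ a ∈ S, a ⬝ᵥ θ + ∑ a ∈ S, √(invForm n d lam S a a) := rfl

end InvForm

section RealInequalities

theorem sqrt_sub_sqrt_sub_le {Q x k : ℝ} (hx : 0 ≤ x) (hxk : x ≤ Q * k) :
    √Q - √(Q - x) ≤ √Q * k := by
  rcases le_or_gt Q 0 with hQ | hQ
  · simp [Real.sqrt_eq_zero_of_nonpos hQ]
  · have hp : 0 < √Q := Real.sqrt_pos.2 hQ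
    have hp2 : √Q ^ 2 = Q := Real.sq_sqrt hQ.le
    have hxp : x ≤ √Q * (√Q * k) := by nlinarith
    rcases le_or_gt (√Q) (√Q * k) with h | h
    · linarith [Real.sqrt_nonneg (Q - x)]
    · have hk : 0 ≤ √Q * k := by
        by_contra! hk
        nlinarith
      have : √Q - √Q * k ≤ √(Q - x) := by
        apply Real.le_sqrt_of_sq_le
        nlinarith
      linarith

theorem sqrt_sub_le_sqrt_sub {X D : ℝ} (hX : √X ≤ 1 / 2) (hD : 0 ≤ D) (hDX : D ≤ X) :
    √(X - D) ≤ √X - D := by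
  have h2 : √X ^ 2 = X := Real.sq_sqrt (hD.trans hDX)
  have h0 := Real.sqrt_nonneg X
  rw [Real.sqrt_le_iff]
  constructor <;> nlinarith

theorem two_mul_div_le_add {Q α β δ u v γ : ℝ} (hQ : 0 < Q) (hα : 0 < α) (hβ : 0 < β)
    (hδ : 0 < δ) :
    2 * (γ * u * v) / δ ≤ u ^ 2 / α * (v ^ 2 / β) / (2 * Q) +
      36 / 25 * Q * (25 / 18 * γ ^ 2 * (α * β) / δ ^ 2) := by
  have h : u ^ 2 / α * (v ^ 2 / β) / (2 * Q) + 36 / 25 * Q * (25 / 18 * γ ^ 2 * (α * β) / δ ^ 2) -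
      2 * (γ * u * v) / δ = (u * v - 2 * γ * α * β * Q / δ) ^ 2 / (2 * α * β * Q) := by
    field_simp
    ring
  have h1 : 0 ≤ (u * v - 2 * γ * α * β * Q / δ) ^ 2 / (2 * α * β * Q) := by positivity
  linarith

theorem joint_decrease_le {α β : ℝ} (Q u v γ : ℝ) (hα : 0 < α) (hβ : 0 < β)
    (hδ : 0 < α * β - γ ^ 2) :
    Q - u ^ 2 / α - (v - u * γ / α) ^ 2 / (β - γ ^ 2 / α) ≤
      Q - u ^ 2 / α - v ^ 2 / β + 2 * (γ * u * v) / (α * β - γ ^ 2) := by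
  have hβδ : β - γ ^ 2 / α = (α * β - γ ^ 2) / α := by field_simp
  rw [hβδ]
  obtain ⟨δ, hδdef⟩ : ∃ δ, δ = α * β - γ ^ 2 := ⟨_, rfl⟩
  rw [← hδdef] at hδ ⊢
  have hβγ : α * β = δ + γ ^ 2 := by rw [hδdef]; ring
  have h : u ^ 2 / α + (v - u * γ / α) ^ 2 / (δ / α) = u ^ 2 / α + v ^ 2 / β -
      2 * (γ * u * v) / δ + (u ^ 2 * γ ^ 2 / (α * δ) + v ^ 2 * γ ^ 2 / (β * δ)) := by
    field_simp
    linear_combination (v ^ 2 * α) * hβγ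
  have h1 : 0 ≤ u ^ 2 * γ ^ 2 / (α * δ) + v ^ 2 * γ ^ 2 / (β * δ) := by positivity
  linarith

theorem sqrt_add_sqrt_le {Q x y A E κ : ℝ} (hQ : 0 < Q) (hx0 : 0 ≤ x) (hx : x ≤ Q / 4)
    (hy0 : 0 ≤ y) (hy : y ≤ Q / 4) (hκ : 0 ≤ κ) (hA : A ≤ Q - x - y + E)
    (hE : E ≤ x * y / (2 * Q) + 36 / 25 * Q * κ) :
    √A + √Q ≤ √(Q - x) + √(Q - y) + √Q * κ := by
  have hp0 : 0 < √Q := Real.sqrt_pos.2 hQ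
  have hp2 : √Q ^ 2 = Q := Real.sq_sqrt hQ.le
  have hb0 : 0 ≤ √(Q - x) := Real.sqrt_nonneg _
  have hc0 : 0 ≤ √(Q - y) := Real.sqrt_nonneg _
  have hb2 : √(Q - x) ^ 2 = Q - x := Real.sq_sqrt (by linarith)
  have hc2 : √(Q - y) ^ 2 = Q - y := Real.sq_sqrt (by linarith)
  have hbp : √(Q - x) ≤ √Q := Real.sqrt_le_sqrt (by linarith)
  have hcp : √(Q - y) ≤ √Q := Real.sqrt_le_sqrt (by linarith)
  generalize √Q = p at *
  generalize √(Q - x) = b at *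
  generalize √(Q - y) = c at *
  have hbl : 43 / 50 * p ≤ b := by nlinarith
  have hcl : 43 / 50 * p ≤ c := by nlinarith
  have hpb : x / (2 * p) ≤ p - b := by
    rw [div_le_iff₀ (by positivity)]
    nlinarith
  have hpc : y / (2 * p) ≤ p - c := by
    rw [div_le_iff₀ (by positivity)]
    nlinarith
  have hprod : x * y / (2 * Q) ≤ 2 * ((p - b) * (p - c)) := by
    calc x * y / (2 * Q) = 2 * (x / (2 * p) * (y / (2 * p))) := by rw [← hp2]; ring
      _ ≤ _ := by
        gcongr
  have hlin : 18 / 25 * Q * κ ≤ p * κ * (b + c - p) := by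
    have := mul_le_mul_of_nonneg_left (show 18 / 25 * p ≤ b + c - p by linarith)
      (mul_nonneg hp0.le hκ)
    rw [← hp2]
    linarith
  have hpκ : 0 ≤ p * κ := by positivity
  have hmain : √A ≤ b + c - p + p * κ := by
    rw [Real.sqrt_le_iff]
    refine ⟨by linarith, ?_⟩
    have hexp : (b + c - p + p * κ) ^ 2 = b ^ 2 + c ^ 2 - p ^ 2 + 2 * ((p - b) * (p - c)) +
        2 * (p * κ * (b + c - p)) + (p * κ) ^ 2 := by ring
    rw [hexp]
    linarith [sq_nonneg (p * κ)]
  linarith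

/-- The mixed second difference of the square root under two rank-one updates. -/
theorem sqrt_mixed_difference_le {Q g h u v γ : ℝ} (hg : 0 ≤ g) (hg3 : g ≤ 1 / 3)
    (hh : 0 ≤ h) (hh3 : h ≤ 1 / 3) (hQ : 0 ≤ Q) (hu : u ^ 2 ≤ Q * g) (hv : v ^ 2 ≤ Q * h)
    (hγ : γ ^ 2 ≤ g * h) :
    √(Q - u ^ 2 / (1 + g) - (v - u * γ / (1 + g)) ^ 2 / (1 + h - γ ^ 2 / (1 + g))) + √Q ≤
      √(Q - u ^ 2 / (1 + g)) + √(Q - v ^ 2 / (1 + h)) +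
        √Q * (25 / 18 * γ ^ 2 * ((1 + g) * (1 + h)) / ((1 + g) * (1 + h) - γ ^ 2) ^ 2) := by
  rcases hQ.eq_or_lt with rfl | hQ
  · have hu0 : u = 0 := by nlinarith
    have hv0 : v = 0 := by nlinarith
    simp [hu0, hv0]
  have hα : 0 < 1 + g := by linarith
  have hβ : 0 < 1 + h := by linarith
  have hδ : 0 < (1 + g) * (1 + h) - γ ^ 2 := by linarith
  have hx : u ^ 2 / (1 + g) ≤ Q / 4 := by
    rw [div_le_iff₀ hα]
    nlinarith
  have hy : v ^ 2 / (1 + h) ≤ Q / 4 := by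
    rw [div_le_iff₀ hβ]
    nlinarith
  exact sqrt_add_sqrt_le hQ (by positivity) hx (by positivity) hy (by positivity)
    (joint_decrease_le Q u v γ hα hβ hδ) (two_mul_div_le_add hQ hα hβ hδ)

theorem rank_one_coefficient_le {g h γ : ℝ} (hg : 0 ≤ g) (hg3 : g ≤ 1 / 3)
    (hh : 0 ≤ h) (hh3 : h ≤ 1 / 3) (hγ : γ ^ 2 ≤ g * h) :
    25 / 18 * γ ^ 2 * ((1 + g) * (1 + h)) / ((1 + g) * (1 + h) - γ ^ 2) ^ 2 ≤
      γ ^ 2 / ((1 + g) * ((1 + g) * (1 + h) - γ ^ 2)) +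
        γ ^ 2 / ((1 + h) * ((1 + g) * (1 + h) - γ ^ 2)) := by
  have hδ : 1 + g + h ≤ (1 + g) * (1 + h) - γ ^ 2 := by linarith
  set δ := (1 + g) * (1 + h) - γ ^ 2
  have hδ0 : 0 < δ := by linarith
  have hpoly : 25 / 18 * ((1 + g) * (1 + h)) ^ 2 ≤ (2 + g + h) * (1 + g + h) := by
    have h4 : (1 + g) * (1 + h) ≤ (2 + g + h) ^ 2 / 4 := by nlinarith [sq_nonneg (g - h)]
    have h5 : ((1 + g) * (1 + h)) ^ 2 ≤ ((2 + g + h) ^ 2 / 4) ^ 2 :=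
      pow_le_pow_left₀ (by positivity) h4 2
    obtain ⟨s, hs⟩ : ∃ s, s = g + h := ⟨_, rfl⟩
    have hs0 : 0 ≤ s := by linarith
    have hs1 : s ≤ 2 / 3 := by linarith
    have h6 : (2 + s) ^ 3 ≤ 288 / 25 * (1 + s) := by
      nlinarith [mul_nonneg hs0 (sub_nonneg.2 hs1), mul_nonneg hs0 (mul_nonneg hs0 (sub_nonneg.2 hs1))]
    have h7 := mul_le_mul_of_nonneg_left h6 (show 0 ≤ 2 + s by linarith)
    have e : 2 + g + h = 2 + s := by linarith
    have e' : 1 + g + h = 1 + s := by linarith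
    rw [e] at h5
    rw [e, e']
    nlinarith
  have hsum : γ ^ 2 / ((1 + g) * δ) + γ ^ 2 / ((1 + h) * δ) =
      γ ^ 2 * ((2 + g + h) * δ) / ((1 + g) * (1 + h) * δ ^ 2) := by
    field_simp
    ring
  have hleft : 25 / 18 * γ ^ 2 * ((1 + g) * (1 + h)) / δ ^ 2 =
      γ ^ 2 * (25 / 18 * ((1 + g) * (1 + h)) ^ 2) / ((1 + g) * (1 + h) * δ ^ 2) := by
    field_simp
  rw [hsum, hleft]
  have hnum : 25 / 18 * ((1 + g) * (1 + h)) ^ 2 ≤ (2 + g + h) * δ :=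
    hpoly.trans (mul_le_mul_of_nonneg_left hδ (by positivity))
  exact div_le_div_of_nonneg_right (mul_le_mul_of_nonneg_left hnum (sq_nonneg γ)) (by positivity)

end RealInequalities

section Psi

variable {n d : ℕ} {lam : ℝ}

theorem psi_nonneg {θ : Fin n × Fin d → ℝ} {S : Finset (Fin n × Fin d → ℝ)}
    (hθ : ∀ a ∈ S, 0 ≤ a ⬝ᵥ θ) : 0 ≤ Psi n d lam θ S :=
  add_nonneg (sum_nonneg hθ) (sum_nonneg fun _ _ => Real.sqrt_nonneg _)

theorem invForm_insert_self (hlam : 0 < lam) {S : Finset (Fin n × Fin d → ℝ)}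
    {a : Fin n × Fin d → ℝ} (ha : a ∉ S) :
    invForm n d lam (insert a S) a a = invForm n d lam S a a / (1 + invForm n d lam S a a) := by
  have h := invForm_self_nonneg hlam S a
  rw [invForm_insert hlam ha]
  field_simp
  ring

theorem psi_le_psi_insert (hlam : 0 < lam) {θ : Fin n × Fin d → ℝ}
    {S : Finset (Fin n × Fin d → ℝ)} {a : Fin n × Fin d → ℝ} (haθ : 0 ≤ a ⬝ᵥ θ)
    (hsmall : ∀ v ∈ S, √(invForm n d lam S v v) ≤ 1 / (S.card : ℝ)) :
    Psi n d lam θ S ≤ Psi n d lam θ (insert a S) := by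
  by_cases ha : a ∈ S
  · rw [insert_eq_of_mem ha]
  have hg := invForm_self_nonneg hlam S a
  rw [psi_eq, psi_eq, sum_insert ha, sum_insert ha, invForm_insert_self hlam ha]
  set g := invForm n d lam S a a
  set k := g / (1 + g) with hk
  have hk0 : 0 ≤ k := by positivity
  have hk1 : k ≤ 1 := by
    rw [hk, div_le_one (by positivity)]
    linarith
  have hterm : ∀ r ∈ S, √(invForm n d lam S r r) - √(invForm n d lam (insert a S) r r) ≤
      1 / (S.card : ℝ) * k := fun r hr => by
    have hcs := sq_invForm_le hlam S r a
    rw [invForm_insert hlam ha, invForm_comm hlam S a r, ← sq]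
    refine (sqrt_sub_sqrt_sub_le (k := k) (by positivity) ?_).trans
      (mul_le_mul_of_nonneg_right (hsmall r hr) hk0)
    rw [hk, ← mul_div_assoc]
    gcongr
  have hsum := sum_le_card_nsmul S _ _ hterm
  rw [sum_sub_distrib, nsmul_eq_mul] at hsum
  have hcard : (S.card : ℝ) * (1 / (S.card : ℝ) * k) ≤ k := by
    rw [← mul_assoc, mul_one_div]
    exact mul_le_of_le_one_left hk0 (div_self_le_one _)
  have hsqrt : k ≤ √k := Real.le_sqrt_of_sq_le (by nlinarith)
  linarith

theorem invForm_self_le_third (hlam : 0 < lam) {S : Finset (Fin n × Fin d → ℝ)}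
    {a : Fin n × Fin d → ℝ} (ha : a ∉ S)
    (h : √(invForm n d lam (insert a S) a a) ≤ 1 / 2) : invForm n d lam S a a ≤ 1 / 3 := by
  have hg := invForm_self_nonneg hlam S a
  rw [invForm_insert_self hlam ha, Real.sqrt_le_iff, div_le_iff₀ (by positivity)] at h
  linarith [h.2]

/-- The two-element exchange form of submodularity. -/
theorem psi_insert_insert_add_le (hlam : 0 < lam) (θ : Fin n × Fin d → ℝ)
    {S : Finset (Fin n × Fin d → ℝ)} {a b : Fin n × Fin d → ℝ} (ha : a ∉ S) (hb : b ∉ S)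
    (hab : a ≠ b) (hS : ∀ v ∈ S, √(invForm n d lam S v v) ≤ 1 / (S.card : ℝ))
    (hSa : √(invForm n d lam (insert a S) a a) ≤ 1 / ((insert a S).card : ℝ))
    (hSb : √(invForm n d lam (insert b S) b b) ≤ 1 / ((insert b S).card : ℝ)) :
    Psi n d lam θ (insert b (insert a S)) + Psi n d lam θ S ≤
      Psi n d lam θ (insert a S) + Psi n d lam θ (insert b S) := by
  have hba : b ∉ insert a S := by simp [hab.symm, hb]
  have hg := invForm_self_nonneg hlam S a
  have hh := invForm_self_nonneg hlam S b
  have hγ := sq_invForm_le hlam S a b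
  have hqa : invForm n d lam (insert b (insert a S)) a a =
      invForm n d lam (insert a S) a a - invForm n d lam S a b ^ 2 / ((1 + invForm n d lam S a a) *
        ((1 + invForm n d lam S a a) * (1 + invForm n d lam S b b) -
          invForm n d lam S a b ^ 2)) := by
    have hδ : 0 < (1 + invForm n d lam S a a) * (1 + invForm n d lam S b b) -
      invForm n d lam S a b ^ 2 := by nlinarith
    have hβδ : 1 + invForm n d lam (insert a S) b b =
        ((1 + invForm n d lam S a a) * (1 + invForm n d lam S b b) -
          invForm n d lam S a b ^ 2) / (1 + invForm n d lam S a a) := by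
      rw [invForm_insert hlam ha, invForm_comm hlam S b a]
      field_simp
      ring
    rw [invForm_insert hlam hba, hβδ, invForm_comm hlam _ b a, invForm_insert hlam ha a b]
    have := hδ.ne'
    field_simp
    ring
  have hqb : invForm n d lam (insert b (insert a S)) b b =
      invForm n d lam (insert b S) b b - invForm n d lam S a b ^ 2 / ((1 + invForm n d lam S b b) *
        ((1 + invForm n d lam S a a) * (1 + invForm n d lam S b b) -
          invForm n d lam S a b ^ 2)) := by
    have hδ : 0 < (1 + invForm n d lam S a a) * (1 + invForm n d lam S b b) -
      invForm n d lam S a b ^ 2 := by nlinarith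
    have hq : invForm n d lam (insert a S) b b = ((1 + invForm n d lam S a a) *
        (1 + invForm n d lam S b b) - invForm n d lam S a b ^ 2) /
          (1 + invForm n d lam S a a) - 1 := by
      rw [invForm_insert hlam ha, invForm_comm hlam S b a]
      field_simp
      ring
    rw [invForm_insert_self hlam hba, invForm_insert_self hlam hb, hq, add_sub_cancel]
    have := hδ.ne'
    field_simp
    ring
  have hqa0 := invForm_self_nonneg hlam (insert b (insert a S)) a
  have hqb0 := invForm_self_nonneg hlam (insert b (insert a S)) b
  simp only [psi_eq, sum_insert ha, sum_insert hb, sum_insert hba]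
  rw [hqa] at hqa0 ⊢
  rw [hqb] at hqb0 ⊢
  have hδ0 : 0 < (1 + invForm n d lam S a a) * (1 + invForm n d lam S b b) -
    invForm n d lam S a b ^ 2 := by nlinarith
  rcases S.eq_empty_or_nonempty with rfl | hne
  · simp only [sum_empty, add_zero]
    have h1 := Real.sqrt_le_sqrt (sub_le_self (invForm n d lam (insert a ∅) a a)
      (show 0 ≤ invForm n d lam ∅ a b ^ 2 / ((1 + invForm n d lam ∅ a a) *
        ((1 + invForm n d lam ∅ a a) * (1 + invForm n d lam ∅ b b) -
          invForm n d lam ∅ a b ^ 2)) by positivity))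
    have h2 := Real.sqrt_le_sqrt (sub_le_self (invForm n d lam (insert b ∅) b b)
      (show 0 ≤ invForm n d lam ∅ a b ^ 2 / ((1 + invForm n d lam ∅ b b) *
        ((1 + invForm n d lam ∅ a a) * (1 + invForm n d lam ∅ b b) -
          invForm n d lam ∅ a b ^ 2)) by positivity))
    linarith
  have hcard : (1 : ℝ) ≤ S.card := by exact_mod_cast hne.card_pos
  have hhalf : 1 / ((S.card : ℝ) + 1) ≤ 1 / 2 :=
    one_div_le_one_div_of_le two_pos (by linarith)
  rw [card_insert_of_notMem ha, Nat.cast_add_one] at hSa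
  rw [card_insert_of_notMem hb, Nat.cast_add_one] at hSb
  replace hSa := hSa.trans hhalf
  replace hSb := hSb.trans hhalf
  have hg3 := invForm_self_le_third hlam ha hSa
  have hh3 := invForm_self_le_third hlam hb hSb
  have hgain_a := sqrt_sub_le_sqrt_sub hSa (by positivity) (sub_nonneg.1 hqa0)
  have hgain_b := sqrt_sub_le_sqrt_sub hSb (by positivity) (sub_nonneg.1 hqb0)
  have hcoef := rank_one_coefficient_le hg hg3 hh hh3 hγ
  set κ := 25 / 18 * invForm n d lam S a b ^ 2 *
    ((1 + invForm n d lam S a a) * (1 + invForm n d lam S b b)) /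
      ((1 + invForm n d lam S a a) * (1 + invForm n d lam S b b) -
        invForm n d lam S a b ^ 2) ^ 2 with hκ
  have hκ0 : 0 ≤ κ := by positivity
  have hterm : ∀ r ∈ S, √(invForm n d lam (insert b (insert a S)) r r) +
      √(invForm n d lam S r r) - √(invForm n d lam (insert a S) r r) -
        √(invForm n d lam (insert b S) r r) ≤ 1 / (S.card : ℝ) * κ := fun r hr => by
    have h := sqrt_mixed_difference_le hg hg3 hh hh3 (invForm_self_nonneg hlam S r)
      (sq_invForm_le hlam S r a) (sq_invForm_le hlam S r b) hγ
    rw [← hκ] at h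
    have hle := mul_le_mul_of_nonneg_right (hS r hr) hκ0
    rw [invForm_insert hlam hba, invForm_comm hlam (insert a S) b r, ← sq]
    simp only [invForm_insert hlam ha, invForm_insert hlam hb, invForm_comm hlam S a r,
      invForm_comm hlam S b r, invForm_comm hlam S b a, ← sq]
    rw [← add_sub_assoc]
    linarith
  have hsum := sum_le_card_nsmul S _ _ hterm
  rw [sum_sub_distrib, sum_sub_distrib, sum_add_distrib, nsmul_eq_mul, ← mul_assoc,
    mul_one_div_cancel (by positivity), one_mul] at hsum
  linarith

end Psi

/-- Submodularity of the LinUCT objective (Theorem 2): `Ψ` is non-negative,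
monotone and submodular over the ground set of `n`-hot vectors. -/
theorem psi_nonneg_monotone_submodular
    (n d : ℕ) (hn : 0 < n) (hd : 0 < d) (lam : ℝ) (hlam : 0 < lam)
    (θ : Fin n × Fin d → ℝ) (hθ : ∀ a, nHot n d a → 0 ≤ a ⬝ᵥ θ)
    (hsmall : ∀ S : Finset (Fin n × Fin d → ℝ), (∀ a ∈ S, nHot n d a) →
      ∀ v ∈ S, Real.sqrt (v ⬝ᵥ (designMat n d lam S)⁻¹ *ᵥ v) ≤ 1 / (S.card : ℝ)) :
    (∀ S : Finset (Fin n × Fin d → ℝ), (∀ a ∈ S, nHot n d a) →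
      0 ≤ Psi n d lam θ S) ∧
    (∀ S : Finset (Fin n × Fin d → ℝ), (∀ a ∈ S, nHot n d a) →
      ∀ a, nHot n d a → Psi n d lam θ S ≤ Psi n d lam θ (insert a S)) ∧
    (∀ S T : Finset (Fin n × Fin d → ℝ), S ⊆ T → (∀ a ∈ T, nHot n d a) →
      ∀ a, nHot n d a → a ∉ T →
      Psi n d lam θ (insert a T) - Psi n d lam θ T
        ≤ Psi n d lam θ (insert a S) - Psi n d lam θ S) := by
  have hins : ∀ {S : Finset (Fin n × Fin d → ℝ)} {a}, nHot n d a → (∀ v ∈ S, nHot n d v) →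
      ∀ v ∈ insert a S, nHot n d v := fun ha hS => forall_mem_insert _ _ _ |>.2 ⟨ha, hS⟩
  refine ⟨fun S hS => psi_nonneg fun a ha => hθ a (hS a ha), fun S hS a ha =>
    psi_le_psi_insert hlam (hθ a ha) (hsmall S hS), fun S T hST hT a ha haT => ?_⟩
  suffices h : ∀ U : Finset (Fin n × Fin d → ℝ), (∀ v ∈ S ∪ U, nHot n d v) → a ∉ S ∪ U →
      Psi n d lam θ (insert a (S ∪ U)) - Psi n d lam θ (S ∪ U) ≤
        Psi n d lam θ (insert a S) - Psi n d lam θ S by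
    rw [← union_eq_right.2 hST] at hT haT ⊢
    exact h T hT haT
  intro U
  induction U using Finset.induction_on with
  | empty => simp
  | insert b U _ ih =>
    rw [union_insert]
    intro hU haU
    obtain ⟨hb, hSU⟩ := (forall_mem_insert _ _ _).1 hU
    obtain ⟨hab, haSU⟩ := not_or.1 (mem_insert.not.1 haU)
    by_cases hbSU : b ∈ S ∪ U
    · rw [insert_eq_of_mem hbSU]
      exact ih hSU haSU
    · have hexch := psi_insert_insert_add_le hlam θ hbSU haSU (Ne.symm hab) (hsmall _ hSU)
        (hsmall _ (hins hb hSU) b (mem_insert_self _ _))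
        (hsmall _ (hins ha hSU) a (mem_insert_self _ _))
      linarith [ih hSU haSU]
end

section
/- Aggregate-loss bound (Lemma A.4): Let V be a positive definite D×D real matrix, u ∈ ℝ^D, and let S ⊂ ℝ^D be a finite nonempty set such that sqrt(vᵀ V^{-1} v) ≤ 1/|S| for every v ∈ S. Then Σ_{v ∈ S} ( sqrt( vᵀ V^{-1} v ) − sqrt( vᵀ (V + u uᵀ)^{-1} v ) ) ≤ sqrt( uᵀ V^{-1} u ). -/
open Matrix Finset

/-- Cauchy–Schwarz for the bilinear form of a real positive semidefinite matrix. -/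
theorem Matrix.PosSemidef.dotProduct_mulVec_sq_le {n : Type*} [Fintype n] {M : Matrix n n ℝ}
    (hM : M.PosSemidef) (x y : n → ℝ) :
    (x ⬝ᵥ M *ᵥ y) ^ 2 ≤ (x ⬝ᵥ M *ᵥ x) * (y ⬝ᵥ M *ᵥ y) := by
  have hsymm : y ⬝ᵥ M *ᵥ x = x ⬝ᵥ M *ᵥ y := by
    have hT : Mᵀ = M := by simpa using hM.isHermitian.eq
    rw [dotProduct_mulVec, ← mulVec_transpose, hT, dotProduct_comm]
  have key := discrim_le_zero (a := y ⬝ᵥ M *ᵥ y) (b := 2 * (x ⬝ᵥ M *ᵥ y)) (c := x ⬝ᵥ M *ᵥ x)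
    (fun t => by
      have h := hM.dotProduct_mulVec_nonneg (x + t • y)
      simp only [star_trivial, mulVec_add, mulVec_smul, add_dotProduct, dotProduct_add,
        smul_dotProduct, dotProduct_smul, smul_eq_mul, hsymm] at h
      linarith)
  rw [discrim] at key
  linarith

/-- The quadratic form of the inverse shrinks at most by the factor `1 + uᵀ V⁻¹ u` under the
rank-one update `V + u uᵀ`. -/
theorem Matrix.PosDef.dotProduct_inv_mulVec_le_rank_one_update {n : Type*} [Fintype n]
    [DecidableEq n] {V : Matrix n n ℝ} (hV : V.PosDef) (u v : n → ℝ) :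
    v ⬝ᵥ V⁻¹ *ᵥ v ≤
      (1 + u ⬝ᵥ V⁻¹ *ᵥ u) * (v ⬝ᵥ (V + vecMulVec u u)⁻¹ *ᵥ v) := by
  have hW : (V + vecMulVec u u).PosDef :=
    hV.add_posSemidef (by simpa using posSemidef_vecMulVec_self_star u)
  set w := (V + vecMulVec u u)⁻¹ *ᵥ v with hw
  have hVdet := (isUnit_iff_isUnit_det V).1 hV.isUnit
  have hWdet := (isUnit_iff_isUnit_det _).1 hW.isUnit
  have hv : V *ᵥ w + (u ⬝ᵥ w) • u = v := by
    have h : (V + vecMulVec u u) *ᵥ w = v := by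
      rw [hw, mulVec_mulVec, mul_nonsing_inv _ hWdet, one_mulVec]
    rw [add_mulVec, vecMulVec_mulVec] at h
    simpa using h
  have hVv : V⁻¹ *ᵥ v = w + (u ⬝ᵥ w) • V⁻¹ *ᵥ u := by
    conv_lhs => rw [← hv]
    rw [mulVec_add, mulVec_smul, mulVec_mulVec, nonsing_inv_mul _ hVdet, one_mulVec]
  have hcs := hV.inv.posSemidef.dotProduct_mulVec_sq_le u v
  have hsymm : v ⬝ᵥ V⁻¹ *ᵥ u = u ⬝ᵥ V⁻¹ *ᵥ v := by
    have hT : (V⁻¹)ᵀ = V⁻¹ := by simpa using hV.inv.isHermitian.eq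
    rw [dotProduct_mulVec, ← mulVec_transpose, hT, dotProduct_comm]
  have hu : u ⬝ᵥ V⁻¹ *ᵥ v = (1 + u ⬝ᵥ V⁻¹ *ᵥ u) * (u ⬝ᵥ w) := by
    rw [hVv, dotProduct_add, dotProduct_smul, smul_eq_mul]
    ring
  have ha : v ⬝ᵥ V⁻¹ *ᵥ v = v ⬝ᵥ w + (u ⬝ᵥ w) * (u ⬝ᵥ V⁻¹ *ᵥ v) := by
    rw [← hsymm]
    conv_lhs => rw [hVv]
    rw [dotProduct_add, dotProduct_smul, smul_eq_mul]
  linear_combination hcs + (1 + u ⬝ᵥ V⁻¹ *ᵥ u) * ha - (u ⬝ᵥ V⁻¹ *ᵥ v) * hu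

/-- If `p ≤ (1 + q) r`, then `√p` exceeds `√r` by at most `√p * √q`. -/
theorem Real.sqrt_sub_sqrt_le_sqrt_mul_sqrt {p q r : ℝ} (hq : 0 ≤ q) (h : p ≤ (1 + q) * r) :
    √p - √r ≤ √p * √q := by
  have h1 : √p ≤ (1 + √q) * √r := by
    calc √p ≤ √((1 + q) * r) := Real.sqrt_le_sqrt h
      _ = √(1 + q) * √r := Real.sqrt_mul (by positivity) r
      _ ≤ (1 + √q) * √r := by
        gcongr
        rw [Real.sqrt_le_left (by positivity)]
        nlinarith [Real.sq_sqrt hq, Real.sqrt_nonneg q]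
  rcases le_total √p √r with hpr | hpr
  · have : 0 ≤ √p * √q := by positivity
    linarith
  · nlinarith [mul_le_mul_of_nonneg_right hpr (Real.sqrt_nonneg q)]

/-- Aggregate-loss bound (Lemma A.4). -/
theorem aggregate_loss_bound
    (D : ℕ) (V : Matrix (Fin D) (Fin D) ℝ) (hV : V.PosDef) (u : Fin D → ℝ)
    (S : Finset (Fin D → ℝ)) (hS : S.Nonempty)
    (hsmall : ∀ v ∈ S, Real.sqrt (v ⬝ᵥ V⁻¹ *ᵥ v) ≤ 1 / (S.card : ℝ)) :
    ∑ v ∈ S, (Real.sqrt (v ⬝ᵥ V⁻¹ *ᵥ v) - Real.sqrt (v ⬝ᵥ (V + vecMulVec u u)⁻¹ *ᵥ v))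
      ≤ Real.sqrt (u ⬝ᵥ V⁻¹ *ᵥ u) := by
  have hq : 0 ≤ u ⬝ᵥ V⁻¹ *ᵥ u := by
    simpa using hV.inv.posSemidef.dotProduct_mulVec_nonneg u
  have hcard : (S.card : ℝ) ≠ 0 := by exact_mod_cast hS.card_ne_zero
  calc _ ≤ ∑ v ∈ S, 1 / (S.card : ℝ) * √(u ⬝ᵥ V⁻¹ *ᵥ u) := by
        refine Finset.sum_le_sum fun v hv => ?_
        exact (Real.sqrt_sub_sqrt_le_sqrt_mul_sqrt hq
          (hV.dotProduct_inv_mulVec_le_rank_one_update u v)).trans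
          (mul_le_mul_of_nonneg_right (hsmall v hv) (Real.sqrt_nonneg _))
    _ = √(u ⬝ᵥ V⁻¹ *ᵥ u) := by
        rw [Finset.sum_const, nsmul_eq_mul]
        field_simp
end
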